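/- Let m, γ, k, k_v > 0, 0 < δ ≤ M, T > 0, f(r) = (k/2)(r − 1/2 − 1/(2r³)) for r > 0, and let φ, ν : ℝ → ℝ be Lipschitz continuous with Lipschitz constants C_φ and C_ν. For i = 1,2 let uᵢ : [0,T] × [0,1] → ℝ be smooth with uᵢ(t,0) = 0, δ ≤ u_{ix} ≤ M on [0,T] × [0,1], set sᵢ(t) = uᵢ(t,1), let p̄ᵢ : [0,T] × [0,1] → ℝ be continuously differentiable, define p̂ᵢ(t,x) = p̄ᵢ(t, uᵢ(t,x)/sᵢ(t)), and suppose uᵢ satisfies: m u_{itt} + γ u_{ixxxx} − ∂_x( f(u_{ix}) + k_v u_{itx} ) − ∂_x( ν(p̂ᵢ) ) = 0 on (0,T) × (0,1); u_{ixx}(t,0) = u_{ixx}(t,1) = 0; and −γ u_{ixxx}(t,1) + f(u_{ix}(t,1)) + k_v u_{itx}(t,1) + ν(p̂ᵢ(t,1)) + φ(sᵢ(t)) = 0 for t ∈ [0,T]. Put u = u₁ − u₂ and p̄ = p̄₁ − p̄₂. Then there exists a constant C₁ > 0 depending only on C_φ, C_ν, k, k_v, δ, M such that for all t ∈ [0,T]: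 d/dt[ (m/2)∫₀¹ u_t(t)² dx + (γ/2)∫₀¹ u_xx(t)² dx + (k/4)∫₀¹ u_x(t)² dx ] + (k_v/2)∫₀¹ u_tx(t)² dx ≤ C₁ (1 + sup_{x∈[0,1]} |∂_x p̄₁(t,x)|² ) ∫₀¹ u_x(t)² dx + C₁ ∫₀¹ p̄(t,x)² dx. -/

import Mathlib

open Set MeasureTheory

/-- The partial derivative in the first (time) variable. -/
noncomputable def timeDeriv (u : ℝ → ℝ → ℝ) : ℝ → ℝ → ℝ :=
  fun t x => deriv (fun τ => u τ x) t

/-- The partial derivative in the second (space) variable. -/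
noncomputable def spaceDeriv (u : ℝ → ℝ → ℝ) : ℝ → ℝ → ℝ :=
  fun t x => deriv (u t) x

/-- The singular elastic response function. -/
noncomputable def elasticResponse (k r : ℝ) : ℝ := (k / 2) * (r - 1 / 2 - 1 / (2 * r ^ 3))

section PartialDerivatives

variable {u v : ℝ → ℝ → ℝ}

lemma hasDerivAt_time_fderiv (hu : Differentiable ℝ (Function.uncurry u)) (t x : ℝ) :
    HasDerivAt (fun τ => u τ x) (fderiv ℝ (Function.uncurry u) (t, x) (1, 0)) t :=
  (hu (t, x)).hasFDerivAt.comp_hasDerivAt (f := fun τ : ℝ => (τ, x)) t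
    ((hasDerivAt_id t).prodMk (hasDerivAt_const t x))

lemma hasDerivAt_space_fderiv (hu : Differentiable ℝ (Function.uncurry u)) (t x : ℝ) :
    HasDerivAt (u t) (fderiv ℝ (Function.uncurry u) (t, x) (0, 1)) x :=
  (hu (t, x)).hasFDerivAt.comp_hasDerivAt (f := fun ξ : ℝ => (t, ξ)) x
    ((hasDerivAt_const x t).prodMk (hasDerivAt_id x))

lemma uncurry_timeDeriv (hu : Differentiable ℝ (Function.uncurry u)) :
    Function.uncurry (timeDeriv u) = fun p => fderiv ℝ (Function.uncurry u) p (1, 0) :=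
  funext fun p => (hasDerivAt_time_fderiv hu p.1 p.2).deriv

lemma uncurry_spaceDeriv (hu : Differentiable ℝ (Function.uncurry u)) :
    Function.uncurry (spaceDeriv u) = fun p => fderiv ℝ (Function.uncurry u) p (0, 1) :=
  funext fun p => (hasDerivAt_space_fderiv hu p.1 p.2).deriv

lemma hasDerivAt_timeDeriv (hu : ContDiff ℝ (⊤ : ℕ∞) (Function.uncurry u)) (t x : ℝ) :
    HasDerivAt (fun τ => u τ x) (timeDeriv u t x) t :=
  (hasDerivAt_time_fderiv (hu.differentiable (by simp)) t x).differentiableAt.hasDerivAt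

lemma hasDerivAt_spaceDeriv (hu : ContDiff ℝ (⊤ : ℕ∞) (Function.uncurry u)) (t x : ℝ) :
    HasDerivAt (u t) (spaceDeriv u t x) x :=
  (hasDerivAt_space_fderiv (hu.differentiable (by simp)) t x).differentiableAt.hasDerivAt

lemma contDiff_timeDeriv (hu : ContDiff ℝ (⊤ : ℕ∞) (Function.uncurry u)) :
    ContDiff ℝ (⊤ : ℕ∞) (Function.uncurry (timeDeriv u)) := by
  rw [uncurry_timeDeriv (hu.differentiable (by simp))]
  exact (hu.fderiv_right (m := (⊤ : ℕ∞)) le_rfl).clm_apply contDiff_const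

lemma contDiff_spaceDeriv (hu : ContDiff ℝ (⊤ : ℕ∞) (Function.uncurry u)) :
    ContDiff ℝ (⊤ : ℕ∞) (Function.uncurry (spaceDeriv u)) := by
  rw [uncurry_spaceDeriv (hu.differentiable (by simp))]
  exact (hu.fderiv_right (m := (⊤ : ℕ∞)) le_rfl).clm_apply contDiff_const

lemma contDiff_slice (hu : ContDiff ℝ (⊤ : ℕ∞) (Function.uncurry u)) (t : ℝ) :
    ContDiff ℝ (⊤ : ℕ∞) (u t) :=
  hu.comp (contDiff_const.prodMk contDiff_id)

lemma continuous_slice (hu : ContDiff ℝ (⊤ : ℕ∞) (Function.uncurry u)) (t : ℝ) :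
    Continuous (u t) := (contDiff_slice hu t).continuous

lemma continuous_time (hu : ContDiff ℝ (⊤ : ℕ∞) (Function.uncurry u)) (x : ℝ) :
    Continuous fun t => u t x :=
  hu.continuous.comp (continuous_id.prodMk continuous_const)

lemma timeDeriv_spaceDeriv_comm (hu : ContDiff ℝ (⊤ : ℕ∞) (Function.uncurry u)) :
    timeDeriv (spaceDeriv u) = spaceDeriv (timeDeriv u) := by
  have hd : Differentiable ℝ (Function.uncurry u) := hu.differentiable (by simp)
  have hf : Differentiable ℝ (fderiv ℝ (Function.uncurry u)) :=
    (hu.fderiv_right (m := (⊤ : ℕ∞)) le_rfl).differentiable (by simp)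
  funext t x
  have h1 := congrFun (uncurry_timeDeriv ((contDiff_spaceDeriv hu).differentiable (by simp))) (t, x)
  have h2 := congrFun (uncurry_spaceDeriv ((contDiff_timeDeriv hu).differentiable (by simp))) (t, x)
  simp only [Function.uncurry_apply_pair] at h1 h2
  rw [h1, h2, uncurry_spaceDeriv hd, uncurry_timeDeriv hd,
    fderiv_clm_apply (hf _) (differentiableAt_const _),
    fderiv_clm_apply (hf _) (differentiableAt_const _)]
  have := (hu.contDiffAt (x := (t, x))).isSymmSndFDerivAt
    (by simpa using WithTop.coe_le_coe.2 (le_top (a := (2 : ℕ∞)))) (1, 0) (0, 1)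
  simpa using this

lemma hasDerivAt_integral_timeDeriv (hu : ContDiff ℝ (⊤ : ℕ∞) (Function.uncurry u)) (a b t : ℝ) :
    HasDerivAt (fun τ => ∫ x in a..b, u τ x) (∫ x in a..b, timeDeriv u t x) t := by
  have hc := (contDiff_timeDeriv hu).continuous
  obtain ⟨C, hC⟩ := ((isCompact_Icc (a := t - 1) (b := t + 1)).prod
    (isCompact_uIcc (a := a) (b := b))).exists_bound_of_continuousOn hc.continuousOn
  refine (intervalIntegral.hasDerivAt_integral_of_dominated_loc_of_deriv_le
    (s := Icc (t - 1) (t + 1)) (bound := fun _ => C) (F' := timeDeriv u)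
    (Icc_mem_nhds (by linarith) (by linarith))
    (.of_forall fun τ => (continuous_slice hu τ).aestronglyMeasurable)
    ((continuous_slice hu t).intervalIntegrable _ _)
    (continuous_slice (contDiff_timeDeriv hu) t).aestronglyMeasurable
    (.of_forall fun x hx τ hτ => hC (τ, x) ⟨hτ, uIoc_subset_uIcc hx⟩)
    intervalIntegrable_const
    (.of_forall fun x _ τ _ => hasDerivAt_timeDeriv hu τ x)).2

lemma hasDerivAt_integral_sq (hu : ContDiff ℝ (⊤ : ℕ∞) (Function.uncurry u)) (a b t : ℝ) :
    HasDerivAt (fun τ => ∫ x in a..b, (u τ x) ^ 2)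
      (2 * ∫ x in a..b, timeDeriv u t x * u t x) t := by
  have hs : ContDiff ℝ (⊤ : ℕ∞) (Function.uncurry fun τ x => (u τ x) ^ 2) := hu.pow 2
  convert hasDerivAt_integral_timeDeriv hs a b t using 1
  rw [← intervalIntegral.integral_const_mul]
  congr 1
  funext x
  have := ((hasDerivAt_timeDeriv hu t x).pow 2).deriv
  simp only [timeDeriv] at this ⊢
  refine Eq.trans ?_ this.symm
  norm_num
  ring

lemma timeDeriv_sub (hu : ContDiff ℝ (⊤ : ℕ∞) (Function.uncurry u))
    (hv : ContDiff ℝ (⊤ : ℕ∞) (Function.uncurry v)) :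
    timeDeriv (fun t x => u t x - v t x) = fun t x => timeDeriv u t x - timeDeriv v t x := by
  funext t x
  exact ((hasDerivAt_timeDeriv hu t x).sub (hasDerivAt_timeDeriv hv t x)).deriv

lemma spaceDeriv_sub (hu : ContDiff ℝ (⊤ : ℕ∞) (Function.uncurry u))
    (hv : ContDiff ℝ (⊤ : ℕ∞) (Function.uncurry v)) :
    spaceDeriv (fun t x => u t x - v t x) = fun t x => spaceDeriv u t x - spaceDeriv v t x := by
  funext t x
  exact ((hasDerivAt_spaceDeriv hu t x).sub (hasDerivAt_spaceDeriv hv t x)).deriv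

end PartialDerivatives

/-- The non-monotone part of the singular elastic response is Lipschitz away from the origin. -/
lemma abs_inv_cube_sub_le {δ a b : ℝ} (hδ : 0 < δ) (ha : δ ≤ a) (hb : δ ≤ b) :
    |1 / a ^ 3 - 1 / b ^ 3| ≤ 3 / δ ^ 4 * |a - b| := by
  have ha0 := hδ.trans_le ha
  have hb0 := hδ.trans_le hb
  have hp : a⁻¹ ≤ δ⁻¹ := inv_anti₀ hδ ha
  have hq : b⁻¹ ≤ δ⁻¹ := inv_anti₀ hδ hb
  have e : 1 / a ^ 3 - 1 / b ^ 3 =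
      -((a - b) * (a⁻¹ * b⁻¹ * (a⁻¹ * a⁻¹ + a⁻¹ * b⁻¹ + b⁻¹ * b⁻¹))) := by
    field_simp
    ring
  rw [e, abs_neg, abs_mul, mul_comm]
  refine mul_le_mul_of_nonneg_right ?_ (abs_nonneg _)
  rw [abs_of_nonneg (by positivity)]
  calc a⁻¹ * b⁻¹ * (a⁻¹ * a⁻¹ + a⁻¹ * b⁻¹ + b⁻¹ * b⁻¹)
      ≤ δ⁻¹ * δ⁻¹ * (δ⁻¹ * δ⁻¹ + δ⁻¹ * δ⁻¹ + δ⁻¹ * δ⁻¹) := by gcongr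
    _ = 3 / δ ^ 4 := by field_simp; ring

/-- One-dimensional Poincaré inequality, in pointwise form. -/
lemma sq_le_integral_sq_deriv {f f' : ℝ → ℝ} (hf : ∀ x, HasDerivAt f (f' x) x)
    (hf' : Continuous f') (h0 : f 0 = 0) {x : ℝ} (hx : x ∈ Icc (0:ℝ) 1) :
    (f x) ^ 2 ≤ ∫ y in (0:ℝ)..1, (f' y) ^ 2 := by
  have hint : ∫ y in (0:ℝ)..x, f' y = f x := by
    rw [intervalIntegral.integral_eq_sub_of_hasDerivAt (fun y _ => hf y)
      (hf'.intervalIntegrable _ _), h0, sub_zero]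
  have hsq : 0 ≤ ∫ y in (0:ℝ)..x, (f' y - f x) ^ 2 :=
    intervalIntegral.integral_nonneg hx.1 fun y _ => sq_nonneg _
  have hexp : ∫ y in (0:ℝ)..x, (f' y - f x) ^ 2 =
      (∫ y in (0:ℝ)..x, (f' y) ^ 2) - 2 * f x * f x + x * (f x) ^ 2 := by
    have : ∀ y, (f' y - f x) ^ 2 = (f' y) ^ 2 - 2 * f x * f' y + (f x) ^ 2 := fun y => by ring
    simp only [this]
    rw [intervalIntegral.integral_add (Continuous.intervalIntegrable (by fun_prop) _ _)
        (Continuous.intervalIntegrable (by fun_prop) _ _),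
      intervalIntegral.integral_sub (Continuous.intervalIntegrable (by fun_prop) _ _)
        (Continuous.intervalIntegrable (by fun_prop) _ _),
      intervalIntegral.integral_const_mul, hint]
    simp
  have hmono : ∫ y in (0:ℝ)..x, (f' y) ^ 2 ≤ ∫ y in (0:ℝ)..1, (f' y) ^ 2 :=
    intervalIntegral.integral_mono_interval le_rfl hx.1 hx.2
      (.of_forall fun y => sq_nonneg _) (Continuous.intervalIntegrable (by fun_prop) _ _)
  nlinarith [sq_nonneg (f x), hx.2]

lemma neg_integral_mul_le {A g : ℝ → ℝ} {c : ℝ} (hc : 0 < c) (hA : ContinuousOn A (Icc 0 1))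
    (hg : Continuous g) :
    -(∫ x in (0:ℝ)..1, A x * g x) ≤
      c / 2 * (∫ x in (0:ℝ)..1, (g x) ^ 2) + 1 / (2 * c) * ∫ x in (0:ℝ)..1, (A x) ^ 2 := by
  have hA' : ContinuousOn A (uIcc 0 1) := by rwa [uIcc_of_le zero_le_one]
  rw [← intervalIntegral.integral_neg, ← intervalIntegral.integral_const_mul,
    ← intervalIntegral.integral_const_mul, ← intervalIntegral.integral_add
      (Continuous.intervalIntegrable (by fun_prop) _ _)
      (ContinuousOn.intervalIntegrable (by fun_prop))]
  refine intervalIntegral.integral_mono_on zero_le_one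
    (ContinuousOn.intervalIntegrable (by fun_prop))
    (ContinuousOn.intervalIntegrable (by fun_prop)) fun x _ => ?_
  have : c / 2 * g x ^ 2 + 1 / (2 * c) * A x ^ 2 + A x * g x = (c * g x + A x) ^ 2 / (2 * c) := by
    field_simp
    ring
  have : 0 ≤ (c * g x + A x) ^ 2 / (2 * c) := by positivity
  linarith

lemma energy_identity {w : ℝ → ℝ → ℝ} (hw : ContDiff ℝ (⊤ : ℕ∞) (Function.uncurry w))
    {m γ k kv t : ℝ} {A : ℝ → ℝ} (hA : ContinuousOn A (Icc 0 1)) (h0 : timeDeriv w t 0 = 0)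
    (hxx0 : spaceDeriv (spaceDeriv w) t 0 = 0) (hxx1 : spaceDeriv (spaceDeriv w) t 1 = 0)
    (heq : ∀ x ∈ Icc (0:ℝ) 1, γ * spaceDeriv (spaceDeriv (spaceDeriv w)) t x =
      k / 2 * spaceDeriv w t x + kv * timeDeriv (spaceDeriv w) t x + A x +
        m * ∫ y in x..1, timeDeriv (timeDeriv w) t y) :
    deriv (fun τ => m / 2 * (∫ x in (0:ℝ)..1, (timeDeriv w τ x) ^ 2) +
        γ / 2 * (∫ x in (0:ℝ)..1, (spaceDeriv (spaceDeriv w) τ x) ^ 2) +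
        k / 4 * (∫ x in (0:ℝ)..1, (spaceDeriv w τ x) ^ 2)) t +
      kv * (∫ x in (0:ℝ)..1, (timeDeriv (spaceDeriv w) t x) ^ 2) =
    -∫ x in (0:ℝ)..1, A x * timeDeriv (spaceDeriv w) t x := by
  have hwt := contDiff_timeDeriv hw
  have hwx := contDiff_spaceDeriv hw
  have hwtt := contDiff_timeDeriv hwt
  have hwxx := contDiff_spaceDeriv hwx
  have hwtx := contDiff_timeDeriv hwx
  have hwxxx := contDiff_spaceDeriv hwxx
  have hwtxx := contDiff_timeDeriv hwxx
  have cwx := continuous_slice hwx t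
  have cwt := continuous_slice hwt t
  have cwtt := continuous_slice hwtt t
  have cwxx := continuous_slice hwxx t
  have cwtx := continuous_slice hwtx t
  have cwxxx := continuous_slice hwxxx t
  have cwtxx := continuous_slice hwtxx t
  have cI : Continuous fun x => ∫ y in x..1, timeDeriv (timeDeriv w) t y := by
    simp only [intervalIntegral.integral_symm (1:ℝ)]
    fun_prop
  rw [((((hasDerivAt_integral_sq hwt 0 1 t).const_mul (m / 2)).fun_add
    ((hasDerivAt_integral_sq hwxx 0 1 t).const_mul (γ / 2))).fun_add
    ((hasDerivAt_integral_sq hwx 0 1 t).const_mul (k / 4))).deriv]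
  have ibp_xx : ∫ x in (0:ℝ)..1,
      timeDeriv (spaceDeriv w) t x * spaceDeriv (spaceDeriv (spaceDeriv w)) t x =
      -∫ x in (0:ℝ)..1,
        timeDeriv (spaceDeriv (spaceDeriv w)) t x * spaceDeriv (spaceDeriv w) t x := by
    rw [intervalIntegral.integral_mul_deriv_eq_deriv_mul
      (u' := timeDeriv (spaceDeriv (spaceDeriv w)) t)
      (v := spaceDeriv (spaceDeriv w) t)
      (fun x _ => by
        simpa only [timeDeriv_spaceDeriv_comm hwx] using hasDerivAt_spaceDeriv hwtx t x)
      (fun x _ => hasDerivAt_spaceDeriv hwxx t x)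
      (cwtxx.intervalIntegrable _ _) (cwxxx.intervalIntegrable _ _), hxx0, hxx1]
    ring
  have ibp_tt : ∫ x in (0:ℝ)..1,
      (∫ y in x..1, timeDeriv (timeDeriv w) t y) * timeDeriv (spaceDeriv w) t x =
      ∫ x in (0:ℝ)..1, timeDeriv (timeDeriv w) t x * timeDeriv w t x := by
    rw [intervalIntegral.integral_mul_deriv_eq_deriv_mul
      (u' := fun x => -timeDeriv (timeDeriv w) t x)
      (v := timeDeriv w t)
      (fun x _ => intervalIntegral.integral_hasDerivAt_left (cwtt.intervalIntegrable _ _)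
        cwtt.stronglyMeasurable.stronglyMeasurableAtFilter cwtt.continuousAt)
      (fun x _ => by
        simpa only [timeDeriv_spaceDeriv_comm hw] using hasDerivAt_spaceDeriv hwt t x)
      (cwtt.neg.intervalIntegrable _ _) (cwtx.intervalIntegrable _ _), h0]
    simp
  have hA' : ContinuousOn A (uIcc 0 1) := by rwa [uIcc_of_le zero_le_one]
  have key : ∫ x in (0:ℝ)..1,
      γ * (timeDeriv (spaceDeriv w) t x * spaceDeriv (spaceDeriv (spaceDeriv w)) t x) =
      ∫ x in (0:ℝ)..1, (k / 2 * (timeDeriv (spaceDeriv w) t x * spaceDeriv w t x) +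
        kv * (timeDeriv (spaceDeriv w) t x) ^ 2 + A x * timeDeriv (spaceDeriv w) t x +
        m * ((∫ y in x..1, timeDeriv (timeDeriv w) t y) * timeDeriv (spaceDeriv w) t x)) := by
    refine intervalIntegral.integral_congr fun x hx => ?_
    rw [uIcc_of_le zero_le_one] at hx
    linear_combination (timeDeriv (spaceDeriv w) t x) * heq x hx
  rw [intervalIntegral.integral_add (ContinuousOn.intervalIntegrable (by fun_prop))
      (ContinuousOn.intervalIntegrable (by fun_prop)),
    intervalIntegral.integral_add (ContinuousOn.intervalIntegrable (by fun_prop))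
      (ContinuousOn.intervalIntegrable (by fun_prop)),
    intervalIntegral.integral_add (ContinuousOn.intervalIntegrable (by fun_prop))
      (ContinuousOn.intervalIntegrable (by fun_prop))] at key
  simp only [intervalIntegral.integral_const_mul, ibp_xx, ibp_tt] at key
  linarith

/-- The momentum balance integrated over `[x, 1]`, where the body stress `g` is merely absolutely
continuous. -/
lemma integrated_momentum_balance {u : ℝ → ℝ → ℝ}
    (hu : ContDiff ℝ (⊤ : ℕ∞) (Function.uncurry u)) {m γ k kv t : ℝ} {g : ℝ → ℝ}
    (hpos : ∀ x ∈ Icc (0:ℝ) 1, 0 < spaceDeriv u t x)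
    (hg : AbsolutelyContinuousOnInterval g 0 1)
    (hpde : ∀ x ∈ Ioo (0:ℝ) 1, m * timeDeriv (timeDeriv u) t x +
      γ * spaceDeriv (spaceDeriv (spaceDeriv (spaceDeriv u))) t x -
      deriv (fun ξ => elasticResponse k (spaceDeriv u t ξ) +
        kv * timeDeriv (spaceDeriv u) t ξ) x - deriv g x = 0) {x : ℝ} (hx : x ∈ Icc (0:ℝ) 1) :
    (-γ * spaceDeriv (spaceDeriv (spaceDeriv u)) t 1 + elasticResponse k (spaceDeriv u t 1) +
        kv * timeDeriv (spaceDeriv u) t 1 + g 1) -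
      (-γ * spaceDeriv (spaceDeriv (spaceDeriv u)) t x + elasticResponse k (spaceDeriv u t x) +
        kv * timeDeriv (spaceDeriv u) t x + g x) =
    m * ∫ y in x..1, timeDeriv (timeDeriv u) t y := by
  have hux := contDiff_spaceDeriv hu
  have huxxx := contDiff_spaceDeriv (contDiff_spaceDeriv hux)
  set F : ℝ → ℝ := fun ξ => elasticResponse k (spaceDeriv u t ξ) +
    kv * timeDeriv (spaceDeriv u) t ξ
  set B : ℝ → ℝ := fun ξ => γ * spaceDeriv (spaceDeriv (spaceDeriv u)) t ξ
  have hFc : ContDiffOn ℝ 1 F (Icc 0 1) := by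
    have h1 : ContDiff ℝ 1 (spaceDeriv u t) := (contDiff_slice hux t).of_le (by simp)
    have h2 : ContDiff ℝ 1 (timeDeriv (spaceDeriv u) t) :=
      (contDiff_slice (contDiff_timeDeriv hux) t).of_le (by simp)
    have h3 : ContDiffOn ℝ 1 (fun ξ => 1 / (2 * (spaceDeriv u t ξ) ^ 3)) (Icc 0 1) :=
      contDiffOn_const.div (by fun_prop) fun ξ hξ => by have := hpos ξ hξ; positivity
    unfold F elasticResponse
    fun_prop
  have hBd : ∀ ξ, HasDerivAt B (γ * spaceDeriv (spaceDeriv (spaceDeriv (spaceDeriv u))) t ξ) ξ :=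
    fun ξ => (hasDerivAt_spaceDeriv huxxx t ξ).const_mul γ
  have hBc : ContDiffOn ℝ 1 B (Icc 0 1) :=
    (((contDiff_slice huxxx t).of_le (by simp)).const_smul γ).contDiffOn
  have hsub : uIcc x 1 ⊆ uIcc 0 1 := by
    rw [uIcc_of_le hx.2, uIcc_of_le zero_le_one]
    exact Icc_subset_Icc_left hx.1
  have h01 : uIcc (0:ℝ) 1 = Icc 0 1 := uIcc_of_le zero_le_one
  have hFa : AbsolutelyContinuousOnInterval F 0 1 :=
    ContDiffOn.absolutelyContinuousOnInterval (by rwa [h01])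
  have hBa : AbsolutelyContinuousOnInterval B 0 1 :=
    ContDiffOn.absolutelyContinuousOnInterval (by rwa [h01])
  have ftc := (((hFa.add hg).sub hBa).mono hsub).integral_deriv_eq_sub
  have hae : ∫ y in x..1, deriv (F + g - B) y = ∫ y in x..1, m * timeDeriv (timeDeriv u) t y := by
    refine intervalIntegral.integral_congr_ae ?_
    filter_upwards [hg.ae_differentiableAt, (measure_singleton (1:ℝ) : volume {(1:ℝ)} = 0) |>
      compl_mem_ae_iff.2] with y hgy hy1 hy
    rw [uIoc_of_le hx.2] at hy
    have hyI : y ∈ Ioo (0:ℝ) 1 := ⟨hx.1.trans_lt hy.1, lt_of_le_of_ne hy.2 hy1⟩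
    have hFy : DifferentiableAt ℝ F y :=
      (hFc.contDiffAt (Icc_mem_nhds hyI.1 hyI.2)).differentiableAt one_ne_zero
    have hgy' := hgy (by rw [h01]; exact Ioo_subset_Icc_self hyI)
    rw [((hFy.hasDerivAt.add hgy'.hasDerivAt).sub (hBd y)).deriv]
    linarith [hpde y hyI]
  rw [hae, intervalIntegral.integral_const_mul] at ftc
  rw [ftc]
  simp only [F, B, Pi.sub_apply, Pi.add_apply]
  ring

lemma mul_sub_le_sub_of_le_deriv {f f' : ℝ → ℝ} {δ : ℝ} (hf : ∀ x, HasDerivAt f (f' x) x)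
    (hδ : ∀ x ∈ Icc (0:ℝ) 1, δ ≤ f' x) {x y : ℝ} (hx : x ∈ Icc (0:ℝ) 1) (hy : y ∈ Icc (0:ℝ) 1)
    (hxy : x ≤ y) : δ * (y - x) ≤ f y - f x :=
  (convex_Icc (0:ℝ) 1).mul_sub_le_image_sub_of_le_deriv
    (fun z _ => (hf z).continuousAt.continuousWithinAt)
    (fun z _ => (hf z).differentiableAt.differentiableWithinAt)
    (fun z hz => by rw [(hf z).deriv]; exact hδ z (interior_subset hz)) x hx y hy hxy

lemma timeDeriv_eq_zero_of_eqOn {u : ℝ → ℝ → ℝ} (hu : ContDiff ℝ (⊤ : ℕ∞) (Function.uncurry u))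
    {T x : ℝ} (hT : 0 < T) (h0 : ∀ t ∈ Icc (0:ℝ) T, u t x = 0) {t : ℝ} (ht : t ∈ Icc (0:ℝ) T) :
    timeDeriv u t x = 0 :=
  (uniqueDiffOn_Icc hT t ht).eq_deriv _ (hasDerivAt_timeDeriv hu t x).hasDerivWithinAt
    ((hasDerivWithinAt_const t (Icc 0 T) (0:ℝ)).congr h0 (h0 t ht))

lemma stress_balance {u p : ℝ → ℝ → ℝ} {φ ν : ℝ → ℝ}
    (hu : ContDiff ℝ (⊤ : ℕ∞) (Function.uncurry u)) (hp : ContDiff ℝ 1 (Function.uncurry p))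
    {m γ k kv T : ℝ} {Kν : NNReal} (hT : 0 < T) (hν : LipschitzWith Kν ν) (hφ : Continuous φ)
    (hpos : ∀ t ∈ Icc (0:ℝ) T, ∀ x ∈ Icc (0:ℝ) 1, 0 < spaceDeriv u t x)
    (hs : ∀ t ∈ Icc (0:ℝ) T, u t 1 ≠ 0)
    (hpde : ∀ t ∈ Ioo (0:ℝ) T, ∀ x ∈ Ioo (0:ℝ) 1, m * timeDeriv (timeDeriv u) t x +
      γ * spaceDeriv (spaceDeriv (spaceDeriv (spaceDeriv u))) t x -
      deriv (fun ξ => elasticResponse k (spaceDeriv u t ξ) +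
        kv * timeDeriv (spaceDeriv u) t ξ) x - deriv (fun ξ => ν (p t (u t ξ / u t 1))) x = 0)
    (hbc : ∀ t ∈ Icc (0:ℝ) T, -γ * spaceDeriv (spaceDeriv (spaceDeriv u)) t 1 +
      elasticResponse k (spaceDeriv u t 1) + kv * timeDeriv (spaceDeriv u) t 1 +
      ν (p t (u t 1 / u t 1)) + φ (u t 1) = 0)
    {t x : ℝ} (ht : t ∈ Icc (0:ℝ) T) (hx : x ∈ Icc (0:ℝ) 1) :
    γ * spaceDeriv (spaceDeriv (spaceDeriv u)) t x =
      elasticResponse k (spaceDeriv u t x) + kv * timeDeriv (spaceDeriv u) t x +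
      ν (p t (u t x / u t 1)) + φ (u t 1) + m * ∫ y in x..1, timeDeriv (timeDeriv u) t y := by
  have hux := contDiff_spaceDeriv hu
  have huxxx := contDiff_spaceDeriv (contDiff_spaceDeriv hux)
  have hutx := contDiff_timeDeriv hux
  have hutt := contDiff_timeDeriv (contDiff_timeDeriv hu)
  have hopen : EqOn (fun t => γ * spaceDeriv (spaceDeriv (spaceDeriv u)) t x)
      (fun t => elasticResponse k (spaceDeriv u t x) + kv * timeDeriv (spaceDeriv u) t x +
      ν (p t (u t x / u t 1)) + φ (u t 1) + m * ∫ y in x..1, timeDeriv (timeDeriv u) t y)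
      (Ioo 0 T) := by
    intro t ht
    have ht' := Ioo_subset_Icc_self ht
    have hg : AbsolutelyContinuousOnInterval (fun ξ => ν (p t (u t ξ / u t 1))) 0 1 := by
      have hc : ContDiff ℝ 1 fun ξ => p t (u t ξ / u t 1) :=
        hp.comp (contDiff_const.prodMk
          (((contDiff_slice hu t).of_le (by simp)).div_const (u t 1)))
      obtain ⟨K, hK⟩ := hc.contDiffOn.exists_lipschitzOnWith one_ne_zero (convex_uIcc (0:ℝ) 1)
        isCompact_uIcc
      exact (hν.comp_lipschitzOnWith hK).absolutelyContinuousOnInterval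
    have := integrated_momentum_balance hu (hpos t ht') hg (hpde t ht) hx
    simp only
    linarith [hbc t ht']
  refine hopen.of_subset_closure (t := Icc 0 T) ?_ ?_ Ioo_subset_Icc_self
    (closure_Ioo hT.ne).ge ht
  · exact (continuous_const.mul (continuous_time huxxx x)).continuousOn
  · have c1 : ContinuousOn (fun t => spaceDeriv u t x) (Icc 0 T) :=
      (continuous_time hux x).continuousOn
    have c2 : Continuous fun t => timeDeriv (spaceDeriv u) t x := continuous_time hutx x
    have c3 : Continuous fun t => ∫ y in x..1, timeDeriv (timeDeriv u) t y :=
      intervalIntegral.continuous_parametric_intervalIntegral_of_continuous' hutt.continuous _ _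
    have c4 : Continuous fun t => u t 1 := continuous_time hu 1
    have c5 : ContinuousOn (fun t => u t x / u t 1) (Icc 0 T) :=
      (continuous_time hu x).continuousOn.div c4.continuousOn hs
    have c6 : ContinuousOn (fun t => p t (u t x / u t 1)) (Icc 0 T) :=
      hp.continuous.comp_continuousOn (continuousOn_id.prodMk c5)
    have c7 : ContinuousOn (fun t => ν (p t (u t x / u t 1))) (Icc 0 T) :=
      hν.continuous.comp_continuousOn c6
    have c8 : ContinuousOn (fun t => 1 / (2 * spaceDeriv u t x ^ 3)) (Icc 0 T) :=
      continuousOn_const.div (by fun_prop) fun t ht => by have := hpos t ht x hx; positivity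
    have c9 : Continuous fun t => φ (u t 1) := hφ.comp c4
    unfold elasticResponse
    exact ((((continuousOn_const.mul ((c1.sub continuousOn_const).sub c8)).add
      (continuousOn_const.mul c2.continuousOn)).add c7).add c9.continuousOn).add
      (continuousOn_const.mul c3.continuousOn)

/-- Comparison of two functions rescaled by their values at the right endpoint. -/
lemma abs_div_sub_div_le {δ U a b s r : ℝ} (hδ : 0 < δ) (hs : δ ≤ s) (hr : 0 < r) (hb : 0 ≤ b)
    (hbr : b ≤ r) (hab : |a - b| ≤ U) (hsr : |s - r| ≤ U) : |a / s - b / r| ≤ 2 / δ * U := by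
  have hs0 := hδ.trans_le hs
  have e : a / s - b / r = ((a - b) - b / r * (s - r)) / s := by
    field_simp
    ring
  have h1 : |b / r * (s - r)| ≤ U := by
    rw [abs_mul, abs_of_nonneg (by positivity)]
    exact (mul_le_of_le_one_left (abs_nonneg _) ((div_le_one hr).2 hbr)).trans hsr
  have hU : 0 ≤ U := (abs_nonneg _).trans hab
  rw [e, abs_div, abs_of_pos hs0, show 2 / δ * U = 2 * U / δ by ring]
  have h2 : |a - b - b / r * (s - r)| ≤ 2 * U := by
    rw [abs_le] at hab h1 ⊢
    constructor <;> linarith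
  gcongr

lemma abs_sub_le_sSup_abs_deriv {q : ℝ → ℝ} (hq : ContDiff ℝ 1 q) {y z : ℝ}
    (hy : y ∈ Icc (0:ℝ) 1) (hz : z ∈ Icc (0:ℝ) 1) :
    |q y - q z| ≤ sSup ((fun ξ => |deriv q ξ|) '' Icc (0:ℝ) 1) * |y - z| := by
  have hb : BddAbove ((fun ξ => |deriv q ξ|) '' Icc (0:ℝ) 1) :=
    isCompact_Icc.bddAbove_image (hq.continuous_deriv le_rfl).abs.continuousOn
  exact (convex_Icc (0:ℝ) 1).norm_image_sub_le_of_norm_deriv_le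
    (fun x _ => (hq.differentiable one_ne_zero).differentiableAt)
    (fun x hx => le_csSup hb (mem_image_of_mem _ hx)) hz hy

/-- The squared `L²` norm after an increasing change of variables of `[0, 1]` with slope at least
`c`. -/
lemma integral_comp_sq_le {q y y' : ℝ → ℝ} {c : ℝ} (hc : 0 < c) (hq : Continuous q)
    (hy : ∀ x, HasDerivAt y (y' x) x) (hy' : Continuous y') (hcy : ∀ x ∈ Icc (0:ℝ) 1, c ≤ y' x)
    (h0 : y 0 = 0) (h1 : y 1 = 1) :
    ∫ x in (0:ℝ)..1, (q (y x)) ^ 2 ≤ c⁻¹ * ∫ x in (0:ℝ)..1, (q x) ^ 2 := by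
  have hyc : Continuous y := continuous_iff_continuousAt.2 fun x => (hy x).continuousAt
  have hcv := intervalIntegral.integral_comp_mul_deriv (a := 0) (b := 1) (g := fun z => (q z) ^ 2)
    (fun x _ => hy x) hy'.continuousOn (by fun_prop)
  rw [h0, h1] at hcv
  rw [← hcv, ← intervalIntegral.integral_const_mul]
  refine intervalIntegral.integral_mono_on zero_le_one
    (Continuous.intervalIntegrable (by fun_prop) _ _)
    (Continuous.intervalIntegrable (by simp only [Function.comp_def]; fun_prop) _ _) fun x hx => ?_
  have : 1 ≤ c⁻¹ * y' x := by
    rw [inv_mul_eq_div, one_le_div hc]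
    exact hcy x hx
  simp only [Function.comp_apply]
  nlinarith [sq_nonneg (q (y x))]

/-- The squared `L²` norm of a function controlled by four contributions. -/
lemma integral_sq_le_of_abs_le {A v q : ℝ → ℝ} {a b c d : ℝ}
    (hA : ContinuousOn A (Icc 0 1)) (hv : Continuous v) (hq : Continuous q)
    (h : ∀ x ∈ Icc (0:ℝ) 1, |A x| ≤ a * |v x| + b + c * |q x| + d) :
    ∫ x in (0:ℝ)..1, (A x) ^ 2 ≤
      4 * (a ^ 2 * (∫ x in (0:ℝ)..1, (v x) ^ 2) + b ^ 2 +
        c ^ 2 * (∫ x in (0:ℝ)..1, (q x) ^ 2) + d ^ 2) := by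
  have hA' : ContinuousOn A (uIcc 0 1) := by rwa [uIcc_of_le zero_le_one]
  have e : 4 * (a ^ 2 * (∫ x in (0:ℝ)..1, (v x) ^ 2) + b ^ 2 +
        c ^ 2 * (∫ x in (0:ℝ)..1, (q x) ^ 2) + d ^ 2) =
      ∫ x in (0:ℝ)..1, 4 * (a ^ 2 * (v x) ^ 2 + c ^ 2 * (q x) ^ 2 + (b ^ 2 + d ^ 2)) := by
    rw [intervalIntegral.integral_const_mul,
      intervalIntegral.integral_add (Continuous.intervalIntegrable (by fun_prop) _ _)
        (Continuous.intervalIntegrable (by fun_prop) _ _),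
      intervalIntegral.integral_add (Continuous.intervalIntegrable (by fun_prop) _ _)
        (Continuous.intervalIntegrable (by fun_prop) _ _),
      intervalIntegral.integral_const_mul, intervalIntegral.integral_const_mul]
    simp
    ring
  rw [e]
  refine intervalIntegral.integral_mono_on zero_le_one
    (ContinuousOn.intervalIntegrable (by fun_prop))
    (Continuous.intervalIntegrable (by fun_prop) _ _) fun x hx => ?_
  have h1 : (A x) ^ 2 ≤ (a * |v x| + b + c * |q x| + d) ^ 2 :=
    sq_le_sq' (abs_le.1 (h x hx)).1 (abs_le.1 (h x hx)).2
  rw [← sq_abs (v x), ← sq_abs (q x)]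
  nlinarith [sq_nonneg (a * |v x| - b), sq_nonneg (a * |v x| - c * |q x|),
    sq_nonneg (a * |v x| - d), sq_nonneg (b - c * |q x|), sq_nonneg (b - d),
    sq_nonneg (c * |q x| - d)]

/-- The difference of the stresses of two solutions, after removal of the linear elastic part. -/
lemma abs_stress_difference_le {k δ Cφ Cν P U : ℝ} {φ ν q₁ q₂ : ℝ → ℝ} (hk : 0 < k) (hδ : 0 < δ)
    (hφ : ∀ a b : ℝ, |φ a - φ b| ≤ Cφ * |a - b|) (hν : ∀ a b : ℝ, |ν a - ν b| ≤ Cν * |a - b|)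
    (hP : ∀ y ∈ Icc (0:ℝ) 1, ∀ z ∈ Icc (0:ℝ) 1, |q₁ y - q₁ z| ≤ P * |y - z|)
    {r₁ r₂ a b s₁ s₂ : ℝ} (hr₁ : δ ≤ r₁) (hr₂ : δ ≤ r₂) (hs₁ : δ ≤ s₁) (hs₂ : δ ≤ s₂)
    (ha : a ∈ Icc 0 s₁) (hb : b ∈ Icc 0 s₂) (hab : |a - b| ≤ U) (hs : |s₁ - s₂| ≤ U) :
    |(elasticResponse k r₁ - elasticResponse k r₂ - k / 2 * (r₁ - r₂)) +
        (ν (q₁ (a / s₁)) - ν (q₂ (b / s₂))) + (φ s₁ - φ s₂)| ≤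
      3 * k / (4 * δ ^ 4) * |r₁ - r₂| + Cν * P * (2 / δ) * U +
        Cν * |q₁ (b / s₂) - q₂ (b / s₂)| + Cφ * U := by
  have hs₁0 := hδ.trans_le hs₁
  have hs₂0 := hδ.trans_le hs₂
  have hCφ : 0 ≤ Cφ := by simpa using (abs_nonneg _).trans (hφ 1 0)
  have hCν : 0 ≤ Cν := by simpa using (abs_nonneg _).trans (hν 1 0)
  have hP0 : 0 ≤ P := by
    simpa using (abs_nonneg _).trans (hP 1 (by simp) 0 (by simp))
  have h1 : |elasticResponse k r₁ - elasticResponse k r₂ - k / 2 * (r₁ - r₂)| ≤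
      3 * k / (4 * δ ^ 4) * |r₁ - r₂| := by
    have e : elasticResponse k r₁ - elasticResponse k r₂ - k / 2 * (r₁ - r₂) =
        -(k / 4 * (1 / r₁ ^ 3 - 1 / r₂ ^ 3)) := by
      have := (hδ.trans_le hr₁).ne'
      have := (hδ.trans_le hr₂).ne'
      unfold elasticResponse
      field_simp
      ring
    rw [e, abs_neg, abs_mul, abs_of_pos (by positivity)]
    calc k / 4 * |1 / r₁ ^ 3 - 1 / r₂ ^ 3| ≤ k / 4 * (3 / δ ^ 4 * |r₁ - r₂|) := by
          gcongr
          exact abs_inv_cube_sub_le hδ hr₁ hr₂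
      _ = 3 * k / (4 * δ ^ 4) * |r₁ - r₂| := by ring
  have h2 : |ν (q₁ (a / s₁)) - ν (q₁ (b / s₂))| ≤ Cν * P * (2 / δ) * U :=
    calc |ν (q₁ (a / s₁)) - ν (q₁ (b / s₂))| ≤ Cν * (P * (2 / δ * U)) := by
          refine (hν _ _).trans (mul_le_mul_of_nonneg_left ?_ hCν)
          refine (hP _ ⟨div_nonneg ha.1 hs₁0.le, (div_le_one hs₁0).2 ha.2⟩ _
            ⟨div_nonneg hb.1 hs₂0.le, (div_le_one hs₂0).2 hb.2⟩).trans
            (mul_le_mul_of_nonneg_left ?_ hP0)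
          exact abs_div_sub_div_le hδ hs₁ hs₂0 hb.1 hb.2 hab hs
      _ = Cν * P * (2 / δ) * U := by ring
  have h3 := hν (q₁ (b / s₂)) (q₂ (b / s₂))
  have h4 : |φ s₁ - φ s₂| ≤ Cφ * U := (hφ _ _).trans (mul_le_mul_of_nonneg_left hs hCφ)
  rw [abs_le] at h1 h2 h3 h4 ⊢
  constructor <;> linarith

/-- Energy estimate for the difference of two solutions of the beam equation
(Lemma 4.1, classical-solution form), the key step in the uniqueness proof for
problem (P); the constant C₁ depends only on C_φ, C_ν, k, k_v, δ, M. -/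
theorem beam_difference_energy_estimate (δ M k kv Cφ Cν : ℝ)
    (hδ : 0 < δ) (hδM : δ ≤ M) (hk : 0 < k) (hkv : 0 < kv) :
    ∃ C₁ > 0, ∀ (m γ T : ℝ), 0 < m → 0 < γ → 0 < T →
      ∀ (φ ν : ℝ → ℝ),
        (∀ a b : ℝ, |φ a - φ b| ≤ Cφ * |a - b|) →
        (∀ a b : ℝ, |ν a - ν b| ≤ Cν * |a - b|) →
      ∀ (u₁ u₂ p₁ p₂ : ℝ → ℝ → ℝ),
        ContDiff ℝ (⊤ : ℕ∞) (Function.uncurry u₁) → ContDiff ℝ (⊤ : ℕ∞) (Function.uncurry u₂) →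
        ContDiff ℝ 1 (Function.uncurry p₁) → ContDiff ℝ 1 (Function.uncurry p₂) →
        (∀ t ∈ Icc (0:ℝ) T, u₁ t 0 = 0) → (∀ t ∈ Icc (0:ℝ) T, u₂ t 0 = 0) →
        (∀ t ∈ Icc (0:ℝ) T, ∀ x ∈ Icc (0:ℝ) 1, deriv (u₁ t) x ∈ Icc δ M) →
        (∀ t ∈ Icc (0:ℝ) T, ∀ x ∈ Icc (0:ℝ) 1, deriv (u₂ t) x ∈ Icc δ M) →
        (∀ t ∈ Ioo (0:ℝ) T, ∀ x ∈ Ioo (0:ℝ) 1,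
          m * deriv (fun τ => deriv (fun σ => u₁ σ x) τ) t +
            γ * deriv (deriv (deriv (deriv (u₁ t)))) x -
            deriv (fun ξ =>
              (k/2) * (deriv (u₁ t) ξ - 1/2 - 1/(2 * (deriv (u₁ t) ξ)^3)) +
                kv * deriv (fun τ => deriv (u₁ τ) ξ) t) x -
            deriv (fun ξ => ν (p₁ t (u₁ t ξ / u₁ t 1))) x = 0) →
        (∀ t ∈ Ioo (0:ℝ) T, ∀ x ∈ Ioo (0:ℝ) 1,
          m * deriv (fun τ => deriv (fun σ => u₂ σ x) τ) t +
            γ * deriv (deriv (deriv (deriv (u₂ t)))) x -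
            deriv (fun ξ =>
              (k/2) * (deriv (u₂ t) ξ - 1/2 - 1/(2 * (deriv (u₂ t) ξ)^3)) +
                kv * deriv (fun τ => deriv (u₂ τ) ξ) t) x -
            deriv (fun ξ => ν (p₂ t (u₂ t ξ / u₂ t 1))) x = 0) →
        (∀ t ∈ Icc (0:ℝ) T, deriv (deriv (u₁ t)) 0 = 0) →
        (∀ t ∈ Icc (0:ℝ) T, deriv (deriv (u₁ t)) 1 = 0) →
        (∀ t ∈ Icc (0:ℝ) T, deriv (deriv (u₂ t)) 0 = 0) →
        (∀ t ∈ Icc (0:ℝ) T, deriv (deriv (u₂ t)) 1 = 0) →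
        (∀ t ∈ Icc (0:ℝ) T,
          -γ * deriv (deriv (deriv (u₁ t))) 1 +
            (k/2) * (deriv (u₁ t) 1 - 1/2 - 1/(2 * (deriv (u₁ t) 1)^3)) +
            kv * deriv (fun τ => deriv (u₁ τ) 1) t +
            ν (p₁ t (u₁ t 1 / u₁ t 1)) + φ (u₁ t 1) = 0) →
        (∀ t ∈ Icc (0:ℝ) T,
          -γ * deriv (deriv (deriv (u₂ t))) 1 +
            (k/2) * (deriv (u₂ t) 1 - 1/2 - 1/(2 * (deriv (u₂ t) 1)^3)) +
            kv * deriv (fun τ => deriv (u₂ τ) 1) t +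
            ν (p₂ t (u₂ t 1 / u₂ t 1)) + φ (u₂ t 1) = 0) →
        ∀ t ∈ Icc (0:ℝ) T,
          deriv (fun τ =>
            (m/2) * (∫ x in (0:ℝ)..1, (deriv (fun σ => u₁ σ x - u₂ σ x) τ)^2) +
            (γ/2) * (∫ x in (0:ℝ)..1, (deriv (deriv (fun ξ => u₁ τ ξ - u₂ τ ξ)) x)^2) +
            (k/4) * (∫ x in (0:ℝ)..1, (deriv (fun ξ => u₁ τ ξ - u₂ τ ξ) x)^2)) t +
          (kv/2) * (∫ x in (0:ℝ)..1,
            (deriv (fun τ => deriv (fun ξ => u₁ τ ξ - u₂ τ ξ) x) t)^2) ≤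
          C₁ * (1 + (sSup ((fun ξ => |deriv (p₁ t) ξ|) '' Icc (0:ℝ) 1))^2) *
            (∫ x in (0:ℝ)..1, (deriv (fun ξ => u₁ t ξ - u₂ t ξ) x)^2) +
          C₁ * (∫ x in (0:ℝ)..1, (p₁ t x - p₂ t x)^2) := by
  refine ⟨2 / kv * ((3 * k / (4 * δ ^ 4)) ^ 2 + (Cν * (2 / δ)) ^ 2 + Cν ^ 2 * (M / δ) + Cφ ^ 2) + 1,
    by have := hδ.trans_le hδM; positivity, ?_⟩
  intro m γ T hm hγ hT φ ν hφ hν u₁ u₂ p₁ p₂ hu₁ hu₂ hp₁ hp₂ hu₁0 hu₂0 hdu₁ hdu₂ hpde₁ hpde₂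
    hxx₁0 hxx₁1 hxx₂0 hxx₂1 hbc₁ hbc₂ t ht
  have hM := hδ.trans_le hδM
  have slope : ∀ {u : ℝ → ℝ → ℝ}, ContDiff ℝ (⊤ : ℕ∞) (Function.uncurry u) →
      (∀ t ∈ Icc (0:ℝ) T, u t 0 = 0) →
      (∀ t ∈ Icc (0:ℝ) T, ∀ x ∈ Icc (0:ℝ) 1, deriv (u t) x ∈ Icc δ M) →
      ∀ t ∈ Icc (0:ℝ) T, δ ≤ u t 1 ∧ u t 1 ≤ M ∧ ∀ x ∈ Icc (0:ℝ) 1, u t x ∈ Icc 0 (u t 1) := by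
    intro u hu h0 hd t ht
    have hlow := fun x y => mul_sub_le_sub_of_le_deriv (x := x) (y := y)
      (hasDerivAt_spaceDeriv hu t) (fun x hx => (hd t ht x hx).1)
    have hup := mul_sub_le_sub_of_le_deriv (x := 0) (y := 1)
      (fun x => (hasDerivAt_spaceDeriv hu t x).neg)
      (fun x hx => neg_le_neg (hd t ht x hx).2) (by simp) (by simp) zero_le_one
    have h01 := hlow 0 1 (by simp) (by simp) zero_le_one
    simp only [Pi.neg_apply] at hup
    rw [h0 t ht] at h01 hup
    refine ⟨by linarith, by linarith, fun x hx => ?_⟩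
    have h0x := hlow 0 x (by simp) hx hx.1
    have hx1 := hlow x 1 hx (by simp) hx.2
    rw [h0 t ht] at h0x
    exact ⟨by nlinarith [hx.1], by nlinarith [hx.2]⟩
  have hs₁ := slope hu₁ hu₁0 hdu₁
  have hs₂ := slope hu₂ hu₂0 hdu₂
  have hνL : LipschitzWith (Real.toNNReal Cν) ν := LipschitzWith.of_dist_le' hν
  have hφc : Continuous φ := (LipschitzWith.of_dist_le' hφ).continuous
  have bal₁ := fun x hx => stress_balance (x := x) hu₁ hp₁ hT hνL hφc
    (fun t ht x hx => hδ.trans_le (hdu₁ t ht x hx).1)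
    (fun t ht => (hδ.trans_le (hs₁ t ht).1).ne') hpde₁ hbc₁ ht hx
  have bal₂ := fun x hx => stress_balance (x := x) hu₂ hp₂ hT hνL hφc
    (fun t ht x hx => hδ.trans_le (hdu₂ t ht x hx).1)
    (fun t ht => (hδ.trans_le (hs₂ t ht).1).ne') hpde₂ hbc₂ ht hx
  set w : ℝ → ℝ → ℝ := fun t x => u₁ t x - u₂ t x
  have hw : ContDiff ℝ (⊤ : ℕ∞) (Function.uncurry w) := hu₁.sub hu₂
  have hu₁x := contDiff_spaceDeriv hu₁
  have hu₂x := contDiff_spaceDeriv hu₂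
  have hu₁xx := contDiff_spaceDeriv hu₁x
  have hu₂xx := contDiff_spaceDeriv hu₂x
  have hu₁t := contDiff_timeDeriv hu₁
  have hu₂t := contDiff_timeDeriv hu₂
  have hwx : spaceDeriv w = fun t x => spaceDeriv u₁ t x - spaceDeriv u₂ t x :=
    spaceDeriv_sub hu₁ hu₂
  have hwxx : spaceDeriv (spaceDeriv w) =
      fun t x => spaceDeriv (spaceDeriv u₁) t x - spaceDeriv (spaceDeriv u₂) t x := by
    rw [hwx, spaceDeriv_sub hu₁x hu₂x]
  have hwxxx : spaceDeriv (spaceDeriv (spaceDeriv w)) = fun t x =>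
      spaceDeriv (spaceDeriv (spaceDeriv u₁)) t x -
        spaceDeriv (spaceDeriv (spaceDeriv u₂)) t x := by
    rw [hwxx, spaceDeriv_sub hu₁xx hu₂xx]
  have hwtx : timeDeriv (spaceDeriv w) =
      fun t x => timeDeriv (spaceDeriv u₁) t x - timeDeriv (spaceDeriv u₂) t x := by
    rw [hwx, timeDeriv_sub hu₁x hu₂x]
  have hwtt : timeDeriv (timeDeriv w) =
      fun t x => timeDeriv (timeDeriv u₁) t x - timeDeriv (timeDeriv u₂) t x := by
    rw [timeDeriv_sub hu₁ hu₂, timeDeriv_sub hu₁t hu₂t]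
  set A : ℝ → ℝ := fun x =>
    (elasticResponse k (spaceDeriv u₁ t x) - elasticResponse k (spaceDeriv u₂ t x) -
      k / 2 * (spaceDeriv u₁ t x - spaceDeriv u₂ t x)) +
    (ν (p₁ t (u₁ t x / u₁ t 1)) - ν (p₂ t (u₂ t x / u₂ t 1))) +
    (φ (u₁ t 1) - φ (u₂ t 1))
  have hp₁t : ContDiff ℝ 1 (p₁ t) := hp₁.comp (contDiff_const.prodMk contDiff_id)
  have hp₂t : ContDiff ℝ 1 (p₂ t) := hp₂.comp (contDiff_const.prodMk contDiff_id)
  have hA : ContinuousOn A (Icc 0 1) := by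
    have elastic : ∀ {u : ℝ → ℝ → ℝ}, ContDiff ℝ (⊤ : ℕ∞) (Function.uncurry u) →
        (∀ t ∈ Icc (0:ℝ) T, ∀ x ∈ Icc (0:ℝ) 1, deriv (u t) x ∈ Icc δ M) →
        ContinuousOn (fun x => elasticResponse k (spaceDeriv u t x)) (Icc 0 1) := by
      intro u hu hd
      have c := (continuous_slice (contDiff_spaceDeriv hu) t).continuousOn (s := Icc 0 1)
      unfold elasticResponse
      refine continuousOn_const.mul ((c.sub continuousOn_const).sub
        (continuousOn_const.div (by fun_prop) fun x hx => ?_))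
      have : 0 < spaceDeriv u t x := hδ.trans_le (hd t ht x hx).1
      positivity
    have c₁ := continuous_slice hu₁ t
    have c₂ := continuous_slice hu₂ t
    have c₃ := continuous_slice hu₁x t
    have c₄ := continuous_slice hu₂x t
    have cν := hνL.continuous
    have cp₁ := hp₁t.continuous
    have cp₂ := hp₂t.continuous
    have cl : Continuous fun x => k / 2 * (spaceDeriv u₁ t x - spaceDeriv u₂ t x) := by fun_prop
    have cn : Continuous fun x => ν (p₁ t (u₁ t x / u₁ t 1)) - ν (p₂ t (u₂ t x / u₂ t 1)) := by
      fun_prop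
    exact ((((elastic hu₁ hdu₁).sub (elastic hu₂ hdu₂)).sub cl.continuousOn).add
      cn.continuousOn).add continuousOn_const
  have energy := energy_identity (k := k) (kv := kv) (m := m) (γ := γ) hw hA
    (timeDeriv_eq_zero_of_eqOn hw hT (fun t ht => by simp [w, hu₁0 t ht, hu₂0 t ht]) ht)
    (by rw [hwxx]; exact sub_eq_zero.2 ((hxx₁0 t ht).trans (hxx₂0 t ht).symm))
    (by rw [hwxx]; exact sub_eq_zero.2 ((hxx₁1 t ht).trans (hxx₂1 t ht).symm))
    (fun x hx => by
      rw [hwxxx, hwtx, hwtt, hwx, intervalIntegral.integral_sub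
        ((continuous_slice (contDiff_timeDeriv hu₁t) t).intervalIntegrable _ _)
        ((continuous_slice (contDiff_timeDeriv hu₂t) t).intervalIntegrable _ _)]
      simp only [A]
      linear_combination bal₁ x hx - bal₂ x hx)
  have cwx := continuous_slice (contDiff_spaceDeriv hw) t
  have young := neg_integral_mul_le hkv hA
    (continuous_slice (contDiff_timeDeriv (contDiff_spaceDeriv hw)) t)
  set P := sSup ((fun ξ => |deriv (p₁ t) ξ|) '' Icc (0:ℝ) 1)
  have hw_sq : ∀ x ∈ Icc (0:ℝ) 1, |w t x| ≤ √(∫ x in (0:ℝ)..1, (spaceDeriv w t x) ^ 2) :=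
    fun x hx => Real.abs_le_sqrt (sq_le_integral_sq_deriv (hasDerivAt_spaceDeriv hw t) cwx
      (by simp [w, hu₁0 t ht, hu₂0 t ht]) hx)
  have I_nonneg : 0 ≤ ∫ x in (0:ℝ)..1, (spaceDeriv w t x) ^ 2 :=
    intervalIntegral.integral_nonneg zero_le_one fun x _ => sq_nonneg _
  have J_nonneg : 0 ≤ ∫ x in (0:ℝ)..1, (p₁ t x - p₂ t x) ^ 2 :=
    intervalIntegral.integral_nonneg zero_le_one fun x _ => sq_nonneg _
  have cq : Continuous fun x => p₁ t x - p₂ t x := hp₁t.continuous.sub hp₂t.continuous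
  obtain ⟨hs₂δ, hs₂M, hu₂s⟩ := hs₂ t ht
  obtain ⟨hs₁δ, -, hu₁s⟩ := hs₁ t ht
  have hs₂pos := hδ.trans_le hs₂δ
  have A_le := integral_sq_le_of_abs_le (v := spaceDeriv w t)
    (q := fun x => p₁ t (u₂ t x / u₂ t 1) - p₂ t (u₂ t x / u₂ t 1)) hA cwx
    (cq.comp ((continuous_slice hu₂ t).div_const (u₂ t 1)))
    (fun x hx => by
      rw [hwx]
      exact abs_stress_difference_le hk hδ hφ hν
        (fun y hy z hz => abs_sub_le_sSup_abs_deriv hp₁t hy hz)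
        (hdu₁ t ht x hx).1 (hdu₂ t ht x hx).1 hs₁δ hs₂δ (hu₁s x hx) (hu₂s x hx)
        (hw_sq x hx) (hw_sq 1 (by simp)))
  have J_le := integral_comp_sq_le (c := δ / M) (y := fun x => u₂ t x / u₂ t 1)
    (by positivity) cq (fun x => (hasDerivAt_spaceDeriv hu₂ t x).div_const (u₂ t 1))
    ((continuous_slice hu₂x t).div_const _)
    (fun x hx => div_le_div₀ (hδ.le.trans (hdu₂ t ht x hx).1) (hdu₂ t ht x hx).1 hs₂pos hs₂M)
    (by simp [hu₂0 t ht]) (div_self hs₂pos.ne')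
  rw [inv_div] at J_le
  simp only [mul_pow, Real.sq_sqrt I_nonneg] at A_le
  change deriv (fun τ => m / 2 * (∫ x in (0:ℝ)..1, (timeDeriv w τ x) ^ 2) +
        γ / 2 * (∫ x in (0:ℝ)..1, (spaceDeriv (spaceDeriv w) τ x) ^ 2) +
        k / 4 * (∫ x in (0:ℝ)..1, (spaceDeriv w τ x) ^ 2)) t +
      kv / 2 * (∫ x in (0:ℝ)..1, (timeDeriv (spaceDeriv w) t x) ^ 2) ≤
    _ * (1 + P ^ 2) * (∫ x in (0:ℝ)..1, (spaceDeriv w t x) ^ 2) + _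
  set I := ∫ x in (0:ℝ)..1, (spaceDeriv w t x) ^ 2
  set J := ∫ x in (0:ℝ)..1, (p₁ t x - p₂ t x) ^ 2
  have bound : 1 / (2 * kv) * (∫ x in (0:ℝ)..1, (A x) ^ 2) ≤
      2 / kv * ((3 * k / (4 * δ ^ 4)) ^ 2 * I + (Cν * (2 / δ)) ^ 2 * (P ^ 2 * I) +
        Cν ^ 2 * (M / δ) * J + Cφ ^ 2 * I) := by
    calc 1 / (2 * kv) * (∫ x in (0:ℝ)..1, (A x) ^ 2) ≤ 1 / (2 * kv) * _ :=
          mul_le_mul_of_nonneg_left (A_le.trans (mul_le_mul_of_nonneg_left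
            (add_le_add_left (add_le_add_right
              (mul_le_mul_of_nonneg_left J_le (sq_nonneg Cν)) _) _) (by norm_num)))
            (by positivity)
      _ = _ := by
          field_simp
          ring
  have hPI : 0 ≤ P ^ 2 * I := by positivity
  have slack : 0 ≤ 2 / kv *
      (((3 * k / (4 * δ ^ 4)) ^ 2 + Cν ^ 2 * (M / δ) + Cφ ^ 2) * (P ^ 2 * I) +
      ((Cν * (2 / δ)) ^ 2 + Cν ^ 2 * (M / δ)) * I +
      ((3 * k / (4 * δ ^ 4)) ^ 2 + (Cν * (2 / δ)) ^ 2 + Cφ ^ 2) * J) := by positivity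
  linarith
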